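/- The function r^{1/2}cos(θ/2), expressed in Cartesian coordinates on the slit plane, belongs to H^s of any bounded neighborhood of the origin for every s < 3/2, but does not belong to H². In particular the crack-tip displacement fields u^I, u^{II} lie in H^{3/2−η} locally for every η>0. -/

import Mathlib

open Real MeasureTheory

namespace CrackTip

/-- truncated power -/
noncomputable def phi (κ : ℝ) : ℝ → ℝ := (Set.Ioo (-2:ℝ) 2).indicator (fun t => |t| ^ (-κ))

lemma phi_eq {κ t : ℝ} (h : |t| < 2) : phi κ t = |t| ^ (-κ) := by
  rw [abs_lt] at h
  exact Set.indicator_of_mem (s := Set.Ioo (-2:ℝ) 2) h _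

lemma phi_nonneg (κ t : ℝ) : 0 ≤ phi κ t :=
  Set.indicator_nonneg (fun _ _ => by positivity) _

lemma phi_neg (κ t : ℝ) : phi κ (-t) = phi κ t := by
  by_cases h : |t| < 2
  · rw [phi_eq h, phi_eq (by rwa [abs_neg]), abs_neg]
  · have h1 : t ∉ Set.Ioo (-2:ℝ) 2 := fun hh => h (abs_lt.2 hh)
    have h2 : -t ∉ Set.Ioo (-2:ℝ) 2 := fun hh => h (by rw [← abs_neg]; exact abs_lt.2 hh)
    simp only [phi, Set.indicator_of_notMem h1, Set.indicator_of_notMem h2]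

lemma phi_integrable {κ : ℝ} (h : κ < 1) : Integrable (phi κ) := by
  have h1 : IntegrableOn (fun t : ℝ => ‖t‖ ^ (-κ)) (Metric.ball (0:ℝ) 2) := by
    rw [integrableOn_fun_norm_addHaar (μ := (volume : Measure ℝ)) (f := fun t : ℝ => t ^ (-κ))]
    simp only [Module.finrank_self, Nat.sub_self, pow_zero, one_smul]
    rw [intervalIntegral.integrableOn_Ioo_rpow_iff (by norm_num)]
    linarith
  rw [phi, integrable_indicator_iff measurableSet_Ioo]
  rw [Real.ball_eq_Ioo] at h1
  simpa using h1

/-- the dominating kernel -/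
noncomputable def T (κ : ℝ) (p : ℝ × ℝ) : ℝ :=
  phi κ p.1 * phi κ p.2 + phi κ p.1 * phi κ (p.1 - p.2) + phi κ p.2 * phi κ (p.1 - p.2)

lemma T_integrable {κ : ℝ} (h : κ < 1) : Integrable (T κ) := by
  have hp := phi_integrable h
  have h1 : Integrable (fun p : ℝ × ℝ => phi κ p.1 * phi κ p.2) := hp.mul_prod hp
  have h3 : Integrable (fun p : ℝ × ℝ => phi κ p.2 * phi κ (p.1 - p.2)) := by
    exact Integrable.convolution_integrand (ContinuousLinearMap.mul ℝ ℝ) hp hp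
  have h2 : Integrable (fun p : ℝ × ℝ => phi κ p.1 * phi κ (p.1 - p.2)) := by
    have := h3.swap
    refine this.congr (Filter.Eventually.of_forall fun p => ?_)
    simp only [Function.comp, Prod.fst_swap, Prod.snd_swap]
    rw [← phi_neg κ (p.2 - p.1), neg_sub]
  exact (h1.add h2).add h3

lemma perm_mp : MeasurePreserving
    (fun q : (ℝ × ℝ) × (ℝ × ℝ) => ((q.1.1, q.2.1), (q.1.2, q.2.2))) volume volume := by
  have a1 := volume_preserving_prodAssoc (α₁ := ℝ) (β₁ := ℝ) (γ₁ := ℝ × ℝ)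
  have a2 := (MeasurePreserving.id (volume : Measure ℝ)).prod
    ((volume_preserving_prodAssoc (α₁ := ℝ) (β₁ := ℝ) (γ₁ := ℝ)).symm)
  have a3 := (MeasurePreserving.id (volume : Measure ℝ)).prod
    ((Measure.measurePreserving_swap (μ := (volume : Measure ℝ)) (ν := (volume : Measure ℝ))).prod
      (MeasurePreserving.id (volume : Measure ℝ)))
  have a4 := (MeasurePreserving.id (volume : Measure ℝ)).prod
    ((volume_preserving_prodAssoc (α₁ := ℝ) (β₁ := ℝ) (γ₁ := ℝ)))
  have a5 := (volume_preserving_prodAssoc (α₁ := ℝ) (β₁ := ℝ) (γ₁ := ℝ × ℝ)).symm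
  exact a5.comp (a4.comp (a3.comp (a2.comp a1)))

lemma TT_integrable {κ : ℝ} (h : κ < 1) :
    Integrable (fun q : (ℝ × ℝ) × (ℝ × ℝ) => T κ (q.1.1, q.2.1) * T κ (q.1.2, q.2.2)) := by
  have h1 : Integrable (fun q : (ℝ × ℝ) × (ℝ × ℝ) => T κ q.1 * T κ q.2) :=
    (T_integrable h).mul_prod (T_integrable h)
  exact perm_mp.integrable_comp_of_integrable h1

lemma ae_ne {E : Type*} [NormedAddCommGroup E] [NormedSpace ℝ E] [MeasurableSpace E]
    [BorelSpace E] [FiniteDimensional ℝ E] (μ : Measure E) [μ.IsAddHaarMeasure]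
    (L : E →L[ℝ] ℝ) (v : E) (hv : L v ≠ 0) : ∀ᵐ q ∂μ, L q ≠ 0 := by
  have := Measure.addHaar_submodule μ (LinearMap.ker (L : E →ₗ[ℝ] ℝ)) (by
    intro h
    have : v ∈ LinearMap.ker (L : E →ₗ[ℝ] ℝ) := by rw [h]; trivial
    exact hv this)
  rw [ae_iff]
  convert this using 2
  ext q; simp

lemma haar2 : (volume : Measure (ℝ × ℝ)).IsAddHaarMeasure :=
  Measure.prod.instIsAddHaarMeasure _ _

lemma haar4 : (volume : Measure ((ℝ × ℝ) × (ℝ × ℝ))).IsAddHaarMeasure :=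
  haveI := haar2
  Measure.prod.instIsAddHaarMeasure _ _

lemma ae_good : ∀ᵐ q : (ℝ × ℝ) × (ℝ × ℝ), q.1.1 ≠ 0 ∧ q.1.2 ≠ 0 ∧ q.2.1 ≠ 0 ∧ q.2.2 ≠ 0 ∧
    q.1.1 - q.2.1 ≠ 0 ∧ q.1.2 - q.2.2 ≠ 0 := by
  have := haar4
  let F1 := ContinuousLinearMap.fst ℝ (ℝ × ℝ) (ℝ × ℝ)
  let F2 := ContinuousLinearMap.snd ℝ (ℝ × ℝ) (ℝ × ℝ)
  let f1 := ContinuousLinearMap.fst ℝ ℝ ℝ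
  let f2 := ContinuousLinearMap.snd ℝ ℝ ℝ
  filter_upwards [ae_ne volume (f1.comp F1) ((1,0),(0,0)) (by simp [f1,F1]),
    ae_ne volume (f2.comp F1) ((0,1),(0,0)) (by simp [f2,F1]),
    ae_ne volume (f1.comp F2) ((0,0),(1,0)) (by simp [f1,F2]),
    ae_ne volume (f2.comp F2) ((0,0),(0,1)) (by simp [f2,F2]),
    ae_ne volume (f1.comp F1 - f1.comp F2) ((1,0),(0,0)) (by simp [f1,F1,F2]),
    ae_ne volume (f2.comp F1 - f2.comp F2) ((0,1),(0,0)) (by simp [f2,F1,F2])]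
    with q h1 h2 h3 h4 h5 h6
  exact ⟨h1, h2, h3, h4, h5, h6⟩

lemma amgm {σ κ a b u : ℝ} (hκ : κ = (3 + 2 * σ) / 4) (hσ : 0 < σ) (hσ' : σ < 1 / 2)
    (ha : 0 < a) (hb : 0 < b) (hu : 0 < u) :
    a ^ (-(3/4):ℝ) * b ^ (-(3/4):ℝ) * u ^ (-σ) ≤
      a ^ (-κ) * b ^ (-κ) + a ^ (-κ) * u ^ (-κ) + b ^ (-κ) * u ^ (-κ) := by
  have hκ0 : 0 < κ := by rw [hκ]; linarith
  set w := σ / (2 * κ) with hw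
  have hwp : 0 < w := by positivity
  have hw1 : 0 ≤ 1 - 2 * w := by
    rw [hw, sub_nonneg, mul_div_assoc', div_le_one (by positivity), hκ]; linarith
  have e2 : 2 * w * κ = σ := by rw [hw]; field_simp
  have key := Real.geom_mean_le_arith_mean3_weighted hw1 hwp.le hwp.le
    (p₁ := a ^ (-κ) * b ^ (-κ)) (p₂ := a ^ (-κ) * u ^ (-κ)) (p₃ := b ^ (-κ) * u ^ (-κ))
    (by positivity) (by positivity) (by positivity) (by ring)
  have e : (a ^ (-κ) * b ^ (-κ)) ^ (1 - 2 * w) * (a ^ (-κ) * u ^ (-κ)) ^ w *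
      (b ^ (-κ) * u ^ (-κ)) ^ w = a ^ (-(3/4):ℝ) * b ^ (-(3/4):ℝ) * u ^ (-σ) := by
    have k1 : (-(3/4):ℝ) = -κ * (1 - 2 * w) + -κ * w := by
      have : κ * (1 - 2 * w) + κ * w = κ - (2 * w * κ) / 2 := by ring
      rw [e2, hκ] at this; rw [hκ]; linarith
    have k2 : -σ = -κ * w + -κ * w := by rw [← e2]; ring
    rw [k1, k2, rpow_add ha, rpow_add hb, rpow_add hu]
    rw [mul_rpow (by positivity) (by positivity), mul_rpow (by positivity) (by positivity),
      mul_rpow (by positivity) (by positivity)]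
    simp only [← rpow_mul ha.le, ← rpow_mul hb.le, ← rpow_mul hu.le]
    ring
  rw [e] at key
  have p1 : 0 ≤ a ^ (-κ) * b ^ (-κ) := by positivity
  have p2 : 0 ≤ a ^ (-κ) * u ^ (-κ) := by positivity
  have p3 : 0 ≤ b ^ (-κ) * u ^ (-κ) := by positivity
  have : w ≤ 1 := by linarith
  nlinarith [mul_le_mul_of_nonneg_right this p2, mul_le_mul_of_nonneg_right this p3,
    mul_nonneg hwp.le p1]

/-- same side of the slit -/
lemma same_side {σ a b a' b' u v R R' D E : ℝ} (hσ : 0 < σ)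
    (ha : 0 < a) (hb : 0 < b) (ha' : 0 < a') (hb' : 0 < b') (hu : 0 < u) (hv : 0 < v)
    (hR0 : 0 < R) (hR0' : 0 < R') (hD0 : 0 < D)
    (hR : a * b ≤ R ^ 2) (hR' : a' * b' ≤ R' ^ 2) (hD : u * v ≤ D ^ 2)
    (hE : E * (R * R' * (R + R')) ≤ D ^ 2) :
    E / D ^ (2 + 2 * σ) ≤ (a ^ (-(3/4):ℝ) * a' ^ (-(3/4):ℝ) * u ^ (-σ)) *
      (b ^ (-(3/4):ℝ) * b' ^ (-(3/4):ℝ) * v ^ (-σ)) := by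
  have h1 : (u * v) ^ σ ≤ D ^ (2 * σ) := by
    rw [rpow_mul hD0.le]
    have := rpow_le_rpow (by positivity) hD hσ.le
    simpa using this
  have h2 : ((a * b) * (a' * b')) ^ (3/4:ℝ) ≤ R * R' * (R + R') := by
    have s1 : ((a * b) * (a' * b')) ^ (3/4:ℝ) ≤ ((R * R') ^ 2) ^ (3/4:ℝ) := by
      apply rpow_le_rpow (by positivity) _ (by norm_num)
      rw [mul_pow]; gcongr
    have s2 : ((R * R') ^ 2) ^ (3/4:ℝ) = (R * R') * sqrt (R * R') := by
      rw [← rpow_natCast, ← rpow_mul (by positivity), sqrt_eq_rpow]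
      rw [show ((2:ℕ):ℝ) * (3/4) = 1 + 1/2 by norm_num, rpow_add (by positivity), rpow_one]
    have s3 : sqrt (R * R') ≤ R + R' := by
      rw [sqrt_le_left (by positivity)]; nlinarith [mul_pos hR0 hR0']
    rw [s2] at s1
    exact s1.trans (by gcongr)
  have e : (a ^ (-(3/4):ℝ) * a' ^ (-(3/4):ℝ) * u ^ (-σ)) *
      (b ^ (-(3/4):ℝ) * b' ^ (-(3/4):ℝ) * v ^ (-σ)) =
      1 / (((a * b) * (a' * b')) ^ (3/4:ℝ) * (u * v) ^ σ) := by
    rw [mul_rpow (by positivity) (by positivity), mul_rpow ha.le hb.le, mul_rpow ha'.le hb'.le,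
      mul_rpow hu.le hv.le]
    simp only [rpow_neg, ha.le, hb.le, ha'.le, hb'.le, hu.le, hv.le]
    field_simp
  rw [e, div_le_div_iff₀ (by positivity) (by positivity), one_mul, rpow_add hD0]
  have p : 0 < ((a * b) * (a' * b')) ^ (3/4:ℝ) := by positivity
  by_cases hE0 : E ≤ 0
  · exact (mul_nonpos_of_nonpos_of_nonneg hE0 (by positivity)).trans (by positivity)
  push Not at hE0
  calc E * (((a * b) * (a' * b')) ^ (3/4:ℝ) * (u * v) ^ σ)
      ≤ E * ((R * R' * (R + R')) * D ^ (2 * σ)) := by gcongr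
    _ = (E * (R * R' * (R + R'))) * D ^ (2 * σ) := by ring
    _ ≤ D ^ 2 * D ^ (2 * σ) := by gcongr
    _ = _ := by rw [← rpow_natCast D 2]; norm_num

/-- opposite sides: one half -/
lemma opp_side {σ κ a b b' u R D : ℝ} (hκ : κ = (3 + 2 * σ) / 4) (hσ : 0 < σ) (hσ' : σ < 1 / 2)
    (ha : 0 < a) (hb : 0 < b) (hb' : 0 < b') (hu : 0 < u)
    (hR0 : 0 < R) (hD0 : 0 < D) (h1 : a ≤ R) (h2 : b ≤ R) (h3 : u ≤ D) (h4 : b ≤ D) (h5 : b' ≤ D) :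
    1 / R / D ^ (2 + 2 * σ) ≤ (a ^ (-κ) * u ^ (-κ)) * (b ^ (-κ) * b' ^ (-κ)) := by
  have q1 : a ^ κ * b ^ (1 - κ) ≤ R := by
    calc a ^ κ * b ^ (1 - κ) ≤ R ^ κ * R ^ (1 - κ) := by
          gcongr <;> rw [hκ] <;> linarith
      _ = R := by rw [← rpow_add hR0]; simp
  have q2 : u ^ κ * b' ^ κ * b ^ (2 * κ - 1) ≤ D ^ (2 + 2 * σ) := by
    calc u ^ κ * b' ^ κ * b ^ (2 * κ - 1) ≤ D ^ κ * D ^ κ * D ^ (2 * κ - 1) := by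
          gcongr <;> rw [hκ] <;> linarith
      _ = _ := by rw [← rpow_add hD0, ← rpow_add hD0]; congr 1; rw [hκ]; ring
  have e : (a ^ (-κ) * u ^ (-κ)) * (b ^ (-κ) * b' ^ (-κ)) =
      1 / ((a ^ κ * b ^ (1 - κ)) * (u ^ κ * b' ^ κ * b ^ (2 * κ - 1))) := by
    have : b ^ κ = b ^ (1 - κ) * b ^ (2 * κ - 1) := by
      rw [← rpow_add hb]; congr 1; ring
    simp only [rpow_neg, ha.le, hb.le, hb'.le, hu.le]
    rw [this]
    field_simp
  rw [e, div_div]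
  apply one_div_le_one_div_of_le (by positivity)
  gcongr

/-- complex coordinate -/
noncomputable def Z : ℝ × ℝ →L[ℝ] ℂ := (Complex.equivRealProdCLM.symm : ℝ × ℝ →L[ℝ] ℂ)

lemma Z_eq (p : ℝ × ℝ) : Z p = (p.1 : ℂ) + (p.2 : ℂ) * Complex.I := by
  simp [Z, Complex.ext_iff]

lemma Z_re (p : ℝ × ℝ) : (Z p).re = p.1 := by simp [Z_eq]
lemma Z_im (p : ℝ × ℝ) : (Z p).im = p.2 := by simp [Z_eq]

lemma Z_norm (p : ℝ × ℝ) : ‖Z p‖ = sqrt (p.1 ^ 2 + p.2 ^ 2) := by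
  rw [Complex.norm_eq_sqrt_sq_add_sq, Z_re, Z_im]

lemma Z_norm_sq (p : ℝ × ℝ) : ‖Z p‖ ^ 2 = p.1 ^ 2 + p.2 ^ 2 := by
  rw [Z_norm, sq_sqrt (by positivity)]

/-- real part of multiplication, as functional -/
noncomputable def Phi : ℂ →L[ℝ] (ℝ × ℝ →L[ℝ] ℝ) :=
  Complex.reCLM.smulRight (ContinuousLinearMap.fst ℝ ℝ ℝ) -
    Complex.imCLM.smulRight (ContinuousLinearMap.snd ℝ ℝ ℝ)

lemma Phi_apply (c : ℂ) (v : ℝ × ℝ) : Phi c v = c.re * v.1 - c.im * v.2 := by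
  simp [Phi]

lemma Phi_norm_le (c : ℂ) : ‖Phi c‖ ≤ 2 * ‖c‖ := by
  apply ContinuousLinearMap.opNorm_le_bound _ (by positivity)
  intro v
  rw [Phi_apply, Real.norm_eq_abs]
  have h1 := Complex.abs_re_le_norm c
  have h2 := Complex.abs_im_le_norm c
  have h3 : |v.1| ≤ ‖v‖ := norm_fst_le v
  have h4 : |v.2| ≤ ‖v‖ := norm_snd_le v
  calc |c.re * v.1 - c.im * v.2| ≤ |c.re * v.1| + |c.im * v.2| := abs_sub _ _
    _ = |c.re| * |v.1| + |c.im| * |v.2| := by rw [abs_mul, abs_mul]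
    _ ≤ ‖c‖ * ‖v‖ + ‖c‖ * ‖v‖ := by gcongr
    _ = _ := by ring

lemma norm_le_Phi (c : ℂ) : ‖c‖ ≤ 2 * ‖Phi c‖ := by
  have h1 := (Phi c).le_opNorm (1, 0)
  have h2 := (Phi c).le_opNorm (0, 1)
  simp [Phi_apply, Prod.norm_def] at h1 h2
  have := Complex.norm_le_abs_re_add_abs_im c
  linarith

/-- complex square root -/
noncomputable def S (p : ℝ × ℝ) : ℂ := Z p ^ ((1/2 : ℝ) : ℂ)
/-- complex derivative -/
noncomputable def G (p : ℝ × ℝ) : ℂ := ((1/2:ℝ):ℂ) * Z p ^ ((-1/2 : ℝ) : ℂ)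
/-- second complex derivative -/
noncomputable def H (p : ℝ × ℝ) : ℂ := ((-1/4:ℝ):ℂ) * Z p ^ ((-3/2 : ℝ) : ℂ)

lemma hasFDerivAt_pow {a : ℝ} {p : ℝ × ℝ} (hp : Z p ∈ Complex.slitPlane) :
    HasFDerivAt (fun p => Z p ^ (a : ℂ))
      (((a : ℂ) * Z p ^ ((a - 1 : ℝ) : ℂ)) • Z) p := by
  have h1 : HasDerivAt (fun z : ℂ => z ^ (a : ℂ)) ((a : ℂ) * Z p ^ ((a - 1 : ℝ) : ℂ)) (Z p) := by
    have := (hasDerivAt_id (Z p)).cpow_const (c := (a:ℂ)) hp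
    simpa using this
  have h2 := (h1.hasFDerivAt.restrictScalars ℝ).comp p Z.hasFDerivAt
  refine h2.congr_fderiv ?_
  ext <;> simp [mul_comm]

lemma hasFDerivAt_S {p : ℝ × ℝ} (hp : Z p ∈ Complex.slitPlane) :
    HasFDerivAt (fun p => (S p).re) (Phi (G p)) p := by
  have h := (Complex.reCLM.hasFDerivAt (x := S p)).comp p (hasFDerivAt_pow (a := 1/2) hp)
  refine h.congr_fderiv ?_
  have : G p = (((1/2:ℝ):ℂ) * Z p ^ (((1/2) - 1 : ℝ) : ℂ)) := by rw [G]; norm_num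
  rw [← this]
  ext <;> simp [Phi_apply, Z_re, Z_im]

lemma slit_open : IsOpen {p | Z p ∈ Complex.slitPlane} :=
  Complex.isOpen_slitPlane.preimage Z.continuous

lemma fderiv_S {p : ℝ × ℝ} (hp : Z p ∈ Complex.slitPlane) :
    fderiv ℝ (fun p => (S p).re) p = Phi (G p) := (hasFDerivAt_S hp).fderiv

lemma hasFDerivAt_G {p : ℝ × ℝ} (hp : Z p ∈ Complex.slitPlane) :
    HasFDerivAt G (H p • Z) p := by
  have h := (hasFDerivAt_pow (a := -1/2) hp).const_mul ((1/2:ℝ):ℂ)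
  refine h.congr_fderiv ?_
  rw [H, smul_smul, ← mul_assoc, ← Complex.ofReal_mul]
  norm_num

lemma fderiv2_S {p : ℝ × ℝ} (hp : Z p ∈ Complex.slitPlane) :
    fderiv ℝ (fun y => fderiv ℝ (fun p => (S p).re) y) p = Phi.comp (H p • Z) := by
  have h1 : (fun y => fderiv ℝ (fun p => (S p).re) y) =ᶠ[nhds p] fun y => Phi (G y) := by
    filter_upwards [slit_open.mem_nhds hp] with y hy using fderiv_S hy
  rw [h1.fderiv_eq]
  exact (Phi.hasFDerivAt.comp p (hasFDerivAt_G hp)).fderiv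

lemma fderiv2_lower {p : ℝ × ℝ} (hp : Z p ∈ Complex.slitPlane) :
    ‖H p‖ ≤ 2 * ‖fderiv ℝ (fun y => fderiv ℝ (fun p => (S p).re) y) p‖ := by
  rw [fderiv2_S hp]
  have h1 := (Phi.comp (H p • Z)).le_opNorm (1, 0)
  have h2 : (Phi.comp (H p • Z)) (1, 0) = Phi (H p) := by
    have : Z (1, 0) = 1 := by simp [Z_eq]
    simp [this]
  have h3 : ‖((1:ℝ), (0:ℝ))‖ = 1 := by simp [Prod.norm_def]
  rw [h2, h3, mul_one] at h1
  linarith [norm_le_Phi (H p)]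

lemma S_sq (p : ℝ × ℝ) : S p ^ 2 = Z p := by
  rw [S, ← Complex.cpow_mul_nat]
  norm_num

lemma S_norm_sq (p : ℝ × ℝ) : ‖S p‖ ^ 2 = ‖Z p‖ := by
  rw [← norm_pow, S_sq]

lemma S_re_pos {p : ℝ × ℝ} (hp : Z p ∈ Complex.slitPlane) : 0 < (S p).re := by
  rw [S, Complex.cpow_ofReal_re]
  have h0 : Z p ≠ 0 := Complex.slitPlane_ne_zero hp
  have := Complex.mem_slitPlane_iff_arg.1 hp
  have h1 := Complex.neg_pi_lt_arg (Z p)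
  have h2 := lt_of_le_of_ne (Complex.arg_le_pi (Z p)) this.1
  have : 0 < cos ((Z p).arg * (1/2)) := cos_pos_of_mem_Ioo ⟨by linarith, by linarith⟩
  have : 0 < ‖Z p‖ := norm_pos_iff.2 h0
  positivity

lemma G_eq {p : ℝ × ℝ} (hp : Z p ∈ Complex.slitPlane) : G p * (2 * S p) = 1 := by
  have h0 : Z p ≠ 0 := Complex.slitPlane_ne_zero hp
  have : Z p ^ ((-1/2 : ℝ) : ℂ) * Z p ^ ((1/2 : ℝ) : ℂ) = 1 := by
    rw [← Complex.cpow_add _ _ h0, ← Complex.ofReal_add]; norm_num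
  rw [G, S]
  calc _ = Z p ^ ((-1/2 : ℝ) : ℂ) * Z p ^ ((1/2 : ℝ) : ℂ) := by push_cast; ring
    _ = 1 := this

lemma f_eq {r θ f : ℝ × ℝ → ℝ}
    (hr : ∀ p, r p = Real.sqrt (p.1 ^ 2 + p.2 ^ 2))
    (hθ : ∀ p, θ p = Complex.arg ((p.1 : ℂ) + (p.2 : ℂ) * Complex.I))
    (hf : ∀ p, f p = Real.sqrt (r p) * Real.cos (θ p / 2)) : f = fun p => (S p).re := by
  funext p
  rw [hf, hr, hθ, S, Complex.cpow_ofReal_re, ← Z_eq, ← Z_norm, sqrt_eq_rpow]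
  congr 2; ring

lemma mem_slit {p : ℝ × ℝ} : Z p ∈ Complex.slitPlane ↔ ¬ (p.2 = 0 ∧ p.1 ≤ 0) := by
  rw [Complex.mem_slitPlane_iff, Z_re, Z_im]
  constructor
  · rintro (h | h) ⟨h1, h2⟩
    · linarith
    · exact h h1
  · intro h
    by_cases h1 : p.2 = 0
    · left; by_contra h2; exact h ⟨h1, by linarith⟩
    · right; exact h1

/-- the squared difference quotient numerator, multiplied out -/
lemma G_diff {p q : ℝ × ℝ} (hp : Z p ∈ Complex.slitPlane) (hq : Z q ∈ Complex.slitPlane) :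
    ‖G p - G q‖ ^ 2 * (4 * (‖Z p‖ * ‖Z q‖)) = ‖S q - S p‖ ^ 2 := by
  have h1 := G_eq hp
  have h2 := G_eq hq
  have : (G p - G q) * (2 * S p * S q) = S q - S p := by linear_combination S q * h1 - S p * h2
  rw [← this, norm_mul, norm_mul, norm_mul, ← S_norm_sq, ← S_norm_sq]
  simp
  ring

lemma same_E {p q : ℝ × ℝ} (hp : Z p ∈ Complex.slitPlane) (hq : Z q ∈ Complex.slitPlane)
    (h : 0 < p.2 * q.2) :
    ‖G p - G q‖ ^ 2 * (‖Z p‖ * ‖Z q‖ * (‖Z p‖ + ‖Z q‖)) ≤ ‖Z p - Z q‖ ^ 2 := by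
  have hd := G_diff hp hq
  have e1 : ‖S q - S p‖ ^ 2 * ‖S q + S p‖ ^ 2 = ‖Z p - Z q‖ ^ 2 := by
    rw [← mul_pow, ← norm_mul, ← norm_neg (Z p - Z q), ← S_sq, ← S_sq]
    congr 2; ring
  have im1 : 2 * (S p).re * (S p).im = p.2 := by
    rw [← Z_im, ← S_sq, sq, Complex.mul_im]; ring
  have im2 : 2 * (S q).re * (S q).im = q.2 := by
    rw [← Z_im, ← S_sq, sq, Complex.mul_im]; ring
  have r1 := S_re_pos hp
  have r2 := S_re_pos hq
  have im3 : 0 < (S p).im * (S q).im := by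
    rw [← im1, ← im2] at h
    have h' : 0 < (4 * ((S p).re * (S q).re)) * ((S p).im * (S q).im) := by nlinarith
    exact (pos_iff_pos_of_mul_pos h').1 (by positivity)
  have e2 : ‖Z p‖ + ‖Z q‖ ≤ ‖S q + S p‖ ^ 2 := by
    rw [← S_norm_sq, ← S_norm_sq, Complex.sq_norm, Complex.sq_norm, Complex.sq_norm,
      Complex.normSq_apply, Complex.normSq_apply, Complex.normSq_apply]
    simp only [Complex.add_re, Complex.add_im]
    nlinarith [mul_pos r1 r2]
  calc ‖G p - G q‖ ^ 2 * (‖Z p‖ * ‖Z q‖ * (‖Z p‖ + ‖Z q‖))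
      ≤ ‖G p - G q‖ ^ 2 * (4 * (‖Z p‖ * ‖Z q‖)) * (‖Z p‖ + ‖Z q‖) := by
        have : 0 ≤ ‖G p - G q‖ ^ 2 * (‖Z p‖ * ‖Z q‖ * (‖Z p‖ + ‖Z q‖)) := by positivity
        nlinarith
    _ = ‖S q - S p‖ ^ 2 * (‖Z p‖ + ‖Z q‖) := by rw [hd]
    _ ≤ ‖S q - S p‖ ^ 2 * ‖S q + S p‖ ^ 2 := by gcongr
    _ = _ := e1

lemma opp_E {p q : ℝ × ℝ} (hp : Z p ∈ Complex.slitPlane) (hq : Z q ∈ Complex.slitPlane) :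
    ‖G p - G q‖ ^ 2 ≤ 1 / ‖Z p‖ + 1 / ‖Z q‖ := by
  have hd := G_diff hp hq
  have h1 : 0 < ‖Z p‖ := norm_pos_iff.2 (Complex.slitPlane_ne_zero hp)
  have h2 : 0 < ‖Z q‖ := norm_pos_iff.2 (Complex.slitPlane_ne_zero hq)
  have h3 : ‖S q - S p‖ ^ 2 ≤ 2 * (‖Z p‖ + ‖Z q‖) := by
    rw [← S_norm_sq p, ← S_norm_sq q]
    have := norm_sub_le (S q) (S p)
    have h0 := norm_nonneg (S q - S p)
    nlinarith [sq_nonneg (‖S q‖ - ‖S p‖)]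
  rw [div_add_div _ _ h1.ne' h2.ne', le_div_iff₀ (by positivity)]
  linarith

lemma G_norm_sq {p : ℝ × ℝ} (hp : Z p ∈ Complex.slitPlane) : ‖G p‖ ^ 2 ≤ 1 / ‖Z p‖ := by
  have h1 : 0 < ‖Z p‖ := norm_pos_iff.2 (Complex.slitPlane_ne_zero hp)
  have h := congrArg (fun z => ‖z‖ ^ 2) (G_eq hp)
  simp only [norm_mul, mul_pow, S_norm_sq] at h
  norm_num at h
  rw [le_div_iff₀ h1]
  have : 0 ≤ ‖G p‖ ^ 2 * ‖Z p‖ := by positivity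
  linarith

lemma G_cont : ContinuousOn G {p | Z p ∈ Complex.slitPlane} :=
  fun _ hp => (hasFDerivAt_G hp).continuousAt.continuousWithinAt

lemma S_cont : ContinuousOn (fun p => (S p).re) {p | Z p ∈ Complex.slitPlane} :=
  fun _ hp => (hasFDerivAt_S hp).continuousAt.continuousWithinAt

lemma H_norm_sq {p : ℝ × ℝ} (hp : Z p ∈ Complex.slitPlane) :
    ‖p‖ ^ (-3 : ℝ) ≤ 128 * ‖H p‖ ^ 2 := by
  have h1 : 0 < ‖Z p‖ := norm_pos_iff.2 (Complex.slitPlane_ne_zero hp)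
  have h2 : ‖Z p‖ ≤ 2 * ‖p‖ := by
    have := Complex.norm_le_abs_re_add_abs_im (Z p)
    rw [Z_re, Z_im] at this
    have h3 : |p.1| ≤ ‖p‖ := norm_fst_le p
    have h4 : |p.2| ≤ ‖p‖ := norm_snd_le p
    linarith
  have h3 : ‖H p‖ ^ 2 = 1/16 * ‖Z p‖ ^ (-3 : ℝ) := by
    rw [H, norm_mul, Complex.norm_cpow_real, mul_pow, ← rpow_natCast (‖Z p‖ ^ (-3/2:ℝ)),
      ← rpow_mul h1.le, Complex.norm_real]
    norm_num
  rw [h3]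
  have h4 : (2 * ‖p‖) ^ (-3:ℝ) ≤ ‖Z p‖ ^ (-3 : ℝ) :=
    rpow_le_rpow_of_nonpos h1 h2 (by norm_num)
  rw [mul_rpow (by norm_num) (by positivity)] at h4
  have : (2:ℝ) ^ (-3:ℝ) = 1/8 := by
    rw [rpow_neg (by norm_num)]; norm_num
  rw [this] at h4
  linarith
end CrackTip

namespace CrackTip

/-- the open slit square -/
def Om : Set (ℝ × ℝ) := Metric.ball (0 : ℝ × ℝ) 1 \ {p : ℝ × ℝ | p.2 = 0 ∧ p.1 ≤ 0}

lemma Om_slit {p : ℝ × ℝ} (hp : p ∈ Om) : Z p ∈ Complex.slitPlane := mem_slit.2 hp.2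

lemma Om_open : IsOpen Om := by
  have : Om = Metric.ball (0 : ℝ × ℝ) 1 ∩ {p | Z p ∈ Complex.slitPlane} := by
    ext p
    simp only [Om, Set.mem_sdiff, Set.mem_inter_iff, Set.mem_ofPred_eq, mem_slit]
  rw [this]
  exact Metric.isOpen_ball.inter slit_open

lemma Om_fst {p : ℝ × ℝ} (hp : p ∈ Om) : |p.1| < 1 :=
  (norm_fst_le p).trans_lt (mem_ball_zero_iff.1 hp.1)

lemma Om_snd {p : ℝ × ℝ} (hp : p ∈ Om) : |p.2| < 1 :=
  (norm_snd_le p).trans_lt (mem_ball_zero_iff.1 hp.1)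

lemma part1 : IntegrableOn (fun p => ((S p).re) ^ 2) Om volume := by
  have hc : ContinuousOn (fun p => ((S p).re) ^ 2) Om :=
    (S_cont.mono fun _ hp => Om_slit hp).pow 2
  refine Integrable.mono' (integrableOn_const (C := (2:ℝ)) ?_)
    (hc.aestronglyMeasurable Om_open.measurableSet) ?_
  · exact ((measure_mono Set.sdiff_subset).trans_lt Metric.isBounded_ball.measure_lt_top).ne
  · filter_upwards [ae_restrict_mem Om_open.measurableSet] with p hp
    have h1 := Complex.abs_re_le_norm (S p)
    have h2 := S_norm_sq p
    have h3 := Complex.norm_le_abs_re_add_abs_im (Z p)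
    rw [Z_re, Z_im] at h3
    have h4 := Om_fst hp
    have h5 := Om_snd hp
    rw [Real.norm_eq_abs, abs_pow]
    calc |(S p).re| ^ 2 ≤ ‖S p‖ ^ 2 := by gcongr
      _ ≤ 2 := by linarith

lemma fderiv_cont : ContinuousOn (fun p => fderiv ℝ (fun p => (S p).re) p) Om :=
  (Phi.continuous.comp_continuousOn (G_cont.mono fun _ hp => Om_slit hp)).congr
    fun _ hp => fderiv_S (Om_slit hp)

lemma part2 : IntegrableOn (fun p => ‖fderiv ℝ (fun p => (S p).re) p‖ ^ 2) Om volume := by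
  have hI : Integrable (fun p : ℝ × ℝ => phi (1/2) p.1 * phi (1/2) p.2) :=
    (phi_integrable (by norm_num)).mul_prod (phi_integrable (by norm_num))
  have hc : ContinuousOn (fun p => ‖fderiv ℝ (fun p => (S p).re) p‖ ^ 2) Om :=
    fderiv_cont.norm.pow 2
  refine Integrable.mono' (hI.const_mul 4).integrableOn
    (hc.aestronglyMeasurable Om_open.measurableSet) ?_
  have := haar2
  filter_upwards [ae_restrict_mem Om_open.measurableSet,
    ae_restrict_of_ae (ae_ne volume (ContinuousLinearMap.fst ℝ ℝ ℝ) (1, 0) (by simp)),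
    ae_restrict_of_ae (ae_ne volume (ContinuousLinearMap.snd ℝ ℝ ℝ) (0, 1) (by simp))]
    with p hp h1 h2
  have ha : 0 < |p.1| := abs_pos.2 h1
  have hb : 0 < |p.2| := abs_pos.2 h2
  rw [phi_eq (by linarith [Om_fst hp]), phi_eq (by linarith [Om_snd hp]), Real.norm_eq_abs,
    abs_of_nonneg (by positivity), fderiv_S (Om_slit hp)]
  have hG := G_norm_sq (Om_slit hp)
  have hP := Phi_norm_le (G p)
  have hZ : |p.1| ^ (1/2:ℝ) * |p.2| ^ (1/2:ℝ) ≤ ‖Z p‖ := by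
    rw [← mul_rpow ha.le hb.le, ← sqrt_eq_rpow, Z_norm]
    apply sqrt_le_sqrt
    nlinarith [sq_nonneg (|p.1| - |p.2|), sq_abs p.1, sq_abs p.2]
  calc ‖Phi (G p)‖ ^ 2 ≤ (2 * ‖G p‖) ^ 2 := by gcongr
    _ = 4 * ‖G p‖ ^ 2 := by ring
    _ ≤ 4 * (1 / ‖Z p‖) := by gcongr
    _ ≤ 4 * (1 / (|p.1| ^ (1/2:ℝ) * |p.2| ^ (1/2:ℝ))) := by gcongr
    _ = _ := by rw [rpow_neg ha.le, rpow_neg hb.le]; field_simp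

set_option maxHeartbeats 2000000 in
lemma bound {σ κ : ℝ} (hκ : κ = (3 + 2 * σ) / 4) (hσ : 0 < σ) (hσ' : σ < 1 / 2)
    {p q : ℝ × ℝ} (hp : p ∈ Om) (hq : q ∈ Om) (h1 : p.1 ≠ 0) (h2 : p.2 ≠ 0) (h3 : q.1 ≠ 0)
    (h4 : q.2 ≠ 0) (h5 : p.1 - q.1 ≠ 0) (h6 : p.2 - q.2 ≠ 0) :
    ‖G p - G q‖ ^ 2 / ‖Z p - Z q‖ ^ (2 + 2 * σ) ≤
      2 * (T κ (p.1, q.1) * T κ (p.2, q.2)) := by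
  have sp := Om_slit hp
  have sq := Om_slit hq
  have a0 : 0 < |p.1| := abs_pos.2 h1
  have b0 : 0 < |p.2| := abs_pos.2 h2
  have a0' : 0 < |q.1| := abs_pos.2 h3
  have b0' : 0 < |q.2| := abs_pos.2 h4
  have u0 : 0 < |p.1 - q.1| := abs_pos.2 h5
  have v0 : 0 < |p.2 - q.2| := abs_pos.2 h6
  have a1 := Om_fst hp
  have b1 := Om_snd hp
  have a1' := Om_fst hq
  have b1' := Om_snd hq
  have u1 := abs_sub p.1 q.1
  have v1 := abs_sub p.2 q.2
  have R0 : 0 < ‖Z p‖ := norm_pos_iff.2 (Complex.slitPlane_ne_zero sp)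
  have R0' : 0 < ‖Z q‖ := norm_pos_iff.2 (Complex.slitPlane_ne_zero sq)
  have zsub : Z p - Z q = Z (p - q) := (map_sub Z p q).symm
  have hDre : |p.1 - q.1| ≤ ‖Z p - Z q‖ := by
    have := Complex.abs_re_le_norm (Z p - Z q)
    rwa [Complex.sub_re, Z_re, Z_re] at this
  have hDim : |p.2 - q.2| ≤ ‖Z p - Z q‖ := by
    have := Complex.abs_im_le_norm (Z p - Z q)
    rwa [Complex.sub_im, Z_im, Z_im] at this
  have D0 : 0 < ‖Z p - Z q‖ := u0.trans_le hDre
  have ra : |p.1| ≤ ‖Z p‖ := by rw [← Z_re]; exact Complex.abs_re_le_norm _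
  have rb : |p.2| ≤ ‖Z p‖ := by rw [← Z_im]; exact Complex.abs_im_le_norm _
  have ra' : |q.1| ≤ ‖Z q‖ := by rw [← Z_re]; exact Complex.abs_re_le_norm _
  have rb' : |q.2| ≤ ‖Z q‖ := by rw [← Z_im]; exact Complex.abs_im_le_norm _
  simp only [T]
  rw [phi_eq (t := p.1) (by linarith), phi_eq (t := p.2) (by linarith),
    phi_eq (t := q.1) (by linarith), phi_eq (t := q.2) (by linarith),
    phi_eq (t := p.1 - q.1) (by linarith), phi_eq (t := p.2 - q.2) (by linarith)]
  rcases lt_or_gt_of_ne (mul_ne_zero h2 h4) with hs | hs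
  · have hE := opp_E sp sq
    have hv : |p.2 - q.2| = |p.2| + |q.2| := by
      rcases mul_neg_iff.1 hs with ⟨x, y⟩ | ⟨x, y⟩
      · rw [abs_of_pos x, abs_of_neg y, abs_of_pos (by linarith)]; ring
      · rw [abs_of_neg x, abs_of_pos y, abs_of_neg (by linarith)]; ring
    have k1 := opp_side hκ hσ hσ' a0 b0 b0' u0 R0 D0 ra rb hDre (by linarith) (by linarith)
    have k2 := opp_side hκ hσ hσ' a0' b0' b0 u0 R0' D0 ra' rb' hDre (by linarith) (by linarith)
    set A := |p.1| ^ (-κ)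
    set B := |p.2| ^ (-κ)
    set A' := |q.1| ^ (-κ)
    set B' := |q.2| ^ (-κ)
    set U := |p.1 - q.1| ^ (-κ)
    set V := |p.2 - q.2| ^ (-κ)
    have pA : 0 ≤ A := by positivity
    have pB : 0 ≤ B := by positivity
    have pA' : 0 ≤ A' := by positivity
    have pB' : 0 ≤ B' := by positivity
    have pU : 0 ≤ U := by positivity
    have pV : 0 ≤ V := by positivity
    calc ‖G p - G q‖ ^ 2 / ‖Z p - Z q‖ ^ (2 + 2 * σ)
        ≤ (1 / ‖Z p‖ + 1 / ‖Z q‖) / ‖Z p - Z q‖ ^ (2 + 2 * σ) := by gcongr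
      _ = 1 / ‖Z p‖ / ‖Z p - Z q‖ ^ (2 + 2 * σ) + 1 / ‖Z q‖ / ‖Z p - Z q‖ ^ (2 + 2 * σ) := by
          rw [add_div]
      _ ≤ A * U * (B * B') + A' * U * (B' * B) := add_le_add k1 k2
      _ = (A * U + A' * U) * (B * B') := by ring
      _ ≤ (A * A' + A * U + A' * U) * (B * B' + B * V + B' * V) := by
          apply mul_le_mul <;> nlinarith [mul_nonneg pA pA', mul_nonneg pB pV, mul_nonneg pB' pV,
            mul_nonneg pA pU, mul_nonneg pA' pU, mul_nonneg pB pB']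
      _ ≤ _ := by
          have : 0 ≤ (A * A' + A * U + A' * U) * (B * B' + B * V + B' * V) := by positivity
          linarith
  · have hE := same_E sp sq hs
    have mm : ∀ {x y r : ℝ}, x ≤ r → y ≤ r → 0 ≤ y → 0 ≤ r → x * y ≤ r ^ 2 :=
      fun hx hy h0 h0' => by rw [_root_.sq]; exact mul_le_mul hx hy h0 h0'
    have k := same_side (σ := σ) hσ a0 b0 a0' b0' u0 v0 R0 R0' D0
      (mm ra rb b0.le R0.le) (mm ra' rb' b0'.le R0'.le) (mm hDre hDim v0.le D0.le) hE
    have m1 := amgm hκ hσ hσ' a0 a0' u0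
    have m2 := amgm hκ hσ hσ' b0 b0' v0
    refine k.trans ((mul_le_mul m1 m2 (by positivity) (by positivity)).trans ?_)
    exact le_mul_of_one_le_left (by positivity) one_le_two

lemma part3 {s : ℝ} (hs : 1 < s) (hs' : s < 3 / 2) : IntegrableOn
        (fun q : (ℝ × ℝ) × (ℝ × ℝ) =>
          ‖fderiv ℝ (fun p => (S p).re) q.1 - fderiv ℝ (fun p => (S p).re) q.2‖ ^ 2 /
            (Real.sqrt ((q.1.1 - q.2.1) ^ 2 + (q.1.2 - q.2.2) ^ 2))
              ^ (2 + 2 * (s - 1)))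
        (Om ×ˢ Om) volume := by
  have hm : MeasurableSet (Om ×ˢ Om) := Om_open.measurableSet.prod Om_open.measurableSet
  have hκ : (3 + 2 * (s - 1)) / 4 < 1 := by linarith
  refine Integrable.mono' ((TT_integrable hκ).const_mul 8).integrableOn ?_ ?_
  · have hc : ContinuousOn (fun q : (ℝ × ℝ) × (ℝ × ℝ) =>
        ‖fderiv ℝ (fun p => (S p).re) q.1 - fderiv ℝ (fun p => (S p).re) q.2‖ ^ 2) (Om ×ˢ Om) :=
      ((fderiv_cont.comp continuousOn_fst fun _ h => h.1).sub
        (fderiv_cont.comp continuousOn_snd fun _ h => h.2)).norm.pow 2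
    have h2 : Measurable (fun q : (ℝ × ℝ) × (ℝ × ℝ) =>
        (Real.sqrt ((q.1.1 - q.2.1) ^ 2 + (q.1.2 - q.2.2) ^ 2)) ^ (2 + 2 * (s - 1))) := by
      fun_prop
    exact ((hc.aestronglyMeasurable hm).aemeasurable.div h2.aemeasurable).aestronglyMeasurable
  · filter_upwards [ae_restrict_mem hm, ae_restrict_of_ae ae_good] with q hq hg
    obtain ⟨h1, h2, h3, h4, h5, h6⟩ := hg
    have hb := bound (σ := s - 1) rfl (by linarith) (by linarith) hq.1 hq.2 h1 h2 h3 h4 h5 h6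
    have hD : Real.sqrt ((q.1.1 - q.2.1) ^ 2 + (q.1.2 - q.2.2) ^ 2) = ‖Z q.1 - Z q.2‖ := by
      rw [← map_sub, Z_norm]; rfl
    rw [hD, Real.norm_eq_abs, abs_of_nonneg (by positivity), fderiv_S (Om_slit hq.1),
      fderiv_S (Om_slit hq.2), ← map_sub]
    have hP := Phi_norm_le (G q.1 - G q.2)
    calc ‖Phi (G q.1 - G q.2)‖ ^ 2 / ‖Z q.1 - Z q.2‖ ^ (2 + 2 * (s - 1))
        ≤ (2 * ‖G q.1 - G q.2‖) ^ 2 / ‖Z q.1 - Z q.2‖ ^ (2 + 2 * (s - 1)) := by gcongr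
      _ = 4 * (‖G q.1 - G q.2‖ ^ 2 / ‖Z q.1 - Z q.2‖ ^ (2 + 2 * (s - 1))) := by ring
      _ ≤ 4 * (2 * (T _ (q.1.1, q.2.1) * T _ (q.1.2, q.2.2))) := by gcongr
      _ = _ := by ring

lemma part4 : ¬ IntegrableOn
    (fun p => ‖fderiv ℝ (fun y => fderiv ℝ (fun p => (S p).re) y) p‖ ^ 2) Om volume := by
  intro h
  have := haar2
  have h1 : IntegrableOn (fun p : ℝ × ℝ => ‖p‖ ^ (-3:ℝ)) Om := by
    refine Integrable.mono' (h.const_mul 512) ?_ ?_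
    · exact (measurable_norm.pow_const _).aestronglyMeasurable
    · filter_upwards [ae_restrict_mem Om_open.measurableSet] with p hp
      have k1 := H_norm_sq (Om_slit hp)
      have k2 := fderiv2_lower (Om_slit hp)
      rw [Real.norm_eq_abs, abs_of_nonneg (by positivity)]
      have k3 := pow_le_pow_left₀ (norm_nonneg _) k2 2
      rw [mul_pow] at k3
      linarith
  have h2 : IntegrableOn (fun p : ℝ × ℝ => ‖p‖ ^ (-3:ℝ)) (Metric.ball 0 1) := by
    refine h1.congr_set_ae ?_
    filter_upwards [ae_ne volume (ContinuousLinearMap.snd ℝ ℝ ℝ) (0, 1) (by simp)] with p hp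
    have : ¬ (p.2 = 0 ∧ p.1 ≤ 0) := fun hh => hp hh.1
    apply propext
    exact ⟨fun hh => ⟨hh, this⟩, fun hh => hh.1⟩
  rw [integrableOn_fun_norm_addHaar (μ := (volume : Measure (ℝ × ℝ)))
    (f := fun t : ℝ => t ^ (-3:ℝ))] at h2
  have h3 : IntegrableOn (fun t : ℝ => t ^ (-2:ℝ)) (Set.Ioo 0 1) := by
    refine h2.congr_fun (fun t ht => ?_) measurableSet_Ioo
    have h0 : (0:ℝ) < t := ht.1
    simp only [Module.finrank_prod, Module.finrank_self, smul_eq_mul]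
    rw [show (-2:ℝ) = 1 + (-3) by norm_num, rpow_add h0]
    simp
  rw [intervalIntegral.integrableOn_Ioo_rpow_iff (by norm_num)] at h3
  norm_num at h3

end CrackTip

/-- Sobolev regularity of `r^{1/2} cos(θ/2)` near the crack tip: on the slit
disk `Ω = B(0,1) ∖ {(x,0) : x ≤ 0}` the function `f = r^{1/2} cos(θ/2)` and
its gradient are square integrable and the Sobolev–Slobodeckij seminorm of the
gradient of order `s − 1` is finite for every `s < 3/2` (with `1 < s`), so
`f ∈ H^s(Ω)`; but the second derivative of `f` is not square integrable, so
`f ∉ H²(Ω)`. -/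
theorem crack_tip_function_sobolev_regularity
    (Ω : Set (ℝ × ℝ))
    (hΩ : Ω = Metric.ball (0 : ℝ × ℝ) 1 \ {p : ℝ × ℝ | p.2 = 0 ∧ p.1 ≤ 0})
    (r θ : ℝ × ℝ → ℝ)
    (hr : ∀ p, r p = Real.sqrt (p.1 ^ 2 + p.2 ^ 2))
    (hθ : ∀ p, θ p = Complex.arg ((p.1 : ℂ) + (p.2 : ℂ) * Complex.I))
    (f : ℝ × ℝ → ℝ)
    (hf : ∀ p, f p = Real.sqrt (r p) * Real.cos (θ p / 2)) :
    (∀ s : ℝ, 1 < s → s < 3 / 2 →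
      IntegrableOn (fun p => (f p) ^ 2) Ω volume ∧
      IntegrableOn (fun p => ‖fderiv ℝ f p‖ ^ 2) Ω volume ∧
      IntegrableOn
        (fun q : (ℝ × ℝ) × (ℝ × ℝ) =>
          ‖fderiv ℝ f q.1 - fderiv ℝ f q.2‖ ^ 2 /
            (Real.sqrt ((q.1.1 - q.2.1) ^ 2 + (q.1.2 - q.2.2) ^ 2))
              ^ (2 + 2 * (s - 1)))
        (Ω ×ˢ Ω) volume) ∧
    ¬ IntegrableOn (fun p => ‖fderiv ℝ (fun y => fderiv ℝ f y) p‖ ^ 2) Ω volume := by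
  have hfe := CrackTip.f_eq hr hθ hf
  have hO : Ω = CrackTip.Om := hΩ
  subst hfe hO
  exact ⟨fun s hs hs' => ⟨CrackTip.part1, CrackTip.part2, CrackTip.part3 hs hs'⟩, CrackTip.part4⟩
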